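/- Let 𝓡 = (R, <, +, 0, …) be an expansion of a densely linearly ordered abelian group with 𝓡 ⊨ DC and 𝓡 ⊨ LUF₂. Let X be a D_Σ-subset of R^n with proj.dim(X) = d, and let π : R^n → R^d be a coordinate projection such that π(X) has nonempty interior. Then there exists a D_Σ-subset Z of R^d with empty interior such that the fiber X ∩ π^{-1}(x) is locally finite for every x ∈ R^d \ Z. -/

import Mathlib

open FirstOrder Set Topology

section CommonDefs

/-- A subset of `R^n` (coded as `Fin n → R`) is definable in the structure `𝓡` (with
universe `R` and language `L`) with parameters. -/
def IsDefinable (L : FirstOrder.Language) {R : Type*} [L.Structure R] {n : ℕ}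
    (X : Set (Fin n → R)) : Prop :=
  Set.Definable (Set.univ : Set R) L X

/-- An open box in `R^n`: a product of `n` open intervals. -/
def OpenBox {R : Type*} [LT R] {n : ℕ} (B : Set (Fin n → R)) : Prop :=
  ∃ c d : Fin n → R, B = {x | ∀ i, c i < x i ∧ x i < d i}

/-- A closed box in `R^n`: a product of `n` closed intervals. -/
def ClosedBox {R : Type*} [LE R] {n : ℕ} (B : Set (Fin n → R)) : Prop :=
  ∃ c d : Fin n → R, B = {x | ∀ i, c i ≤ x i ∧ x i ≤ d i}

/-- A subset of `R` which is a finite union of points and open intervals. -/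
def FinUnionPtsIntervals {R : Type*} [Preorder R] (s : Set R) : Prop :=
  ∃ (P : Finset R) (Q : Finset (R × R)), s = ↑P ∪ ⋃ p ∈ Q, Set.Ioo p.1 p.2

/-- The fiber `X_x ⊆ R` of a set `X ⊆ R^{m+1}` over `x ∈ R^m`. -/
def fiber1 {R : Type*} {m : ℕ} (X : Set (Fin (m + 1) → R)) (x : Fin m → R) : Set R :=
  {y | Fin.snoc x y ∈ X}

/-- The fiber `X_x ⊆ R^n` of a set `X ⊆ R^{m+n}` over `x ∈ R^m`. -/
def fiberN {R : Type*} {m n : ℕ} (X : Set (Fin (m + n) → R)) (x : Fin m → R) :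
    Set (Fin n → R) :=
  {y | Fin.append x y ∈ X}

/-- The member `X_{r,s} ⊆ R^n` of a parameterized family coded by `F ⊆ R^{2+n}`. -/
def famFiber {R : Type*} {n : ℕ} (F : Set (Fin (2 + n) → R)) (r s : R) : Set (Fin n → R) :=
  {y | Fin.append ![r, s] y ∈ F}

/-- A bounded subset of `R^n`: contained in some closed box. -/
def BddSet {R : Type*} [LE R] {n : ℕ} (X : Set (Fin n → R)) : Prop :=
  ∃ c d : R, ∀ y ∈ X, ∀ i, c ≤ y i ∧ y i ≤ d

/-- A discrete subset of a topological space: each of its points is isolated. -/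
def DiscreteSet {α : Type*} [TopologicalSpace α] (S : Set α) : Prop :=
  ∀ y ∈ S, ∃ U : Set α, IsOpen U ∧ y ∈ U ∧ U ∩ S = {y}

/-- A locally finite subset: each point of the space has an open neighborhood meeting
the set in a finite set. -/
def LocFin {α : Type*} [TopologicalSpace α] (S : Set α) : Prop :=
  ∀ x : α, ∃ U : Set α, IsOpen U ∧ x ∈ U ∧ (S ∩ U).Finite

/-- `F ⊆ R^{2+n}` codes a `D_Σ`-family `{X_{r,s}}_{r>0,s>0}` of CBD subsets of `R^n`:
each fiber is closed, bounded and definable, the family is increasing in `r` and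
decreasing in `s`. -/
def IsDSigmaFamily (L : FirstOrder.Language) {R : Type*} [L.Structure R] [LinearOrder R]
    [Zero R] [TopologicalSpace R] {n : ℕ} (F : Set (Fin (2 + n) → R)) : Prop :=
  IsDefinable L F ∧
    (∀ r s : R, 0 < r → 0 < s →
      IsDefinable L (famFiber F r s) ∧ IsClosed (famFiber F r s) ∧ BddSet (famFiber F r s)) ∧
    (∀ r r' s : R, 0 < r → 0 < s → r ≤ r' → famFiber F r s ⊆ famFiber F r' s) ∧
    (∀ r s s' : R, 0 < r → 0 < s → s ≤ s' → famFiber F r s' ⊆ famFiber F r s)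

/-- A `D_Σ`-set: the union `⋃_{r>0,s>0} X_{r,s}` of a `D_Σ`-family. -/
def IsDSigma (L : FirstOrder.Language) {R : Type*} [L.Structure R] [LinearOrder R]
    [Zero R] [TopologicalSpace R] {n : ℕ} (X : Set (Fin n → R)) : Prop :=
  ∃ F : Set (Fin (2 + n) → R), IsDSigmaFamily L F ∧
    X = ⋃ (r : R) (_ : 0 < r) (s : R) (_ : 0 < s), famFiber F r s

/-- Constructible sets: finite boolean combinations of open sets. -/
inductive IsConstructibleSet {α : Type*} [TopologicalSpace α] : Set α → Prop
  | of_isOpen (s : Set α) : IsOpen s → IsConstructibleSet s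
  | compl (s : Set α) : IsConstructibleSet s → IsConstructibleSet sᶜ
  | union (s t : Set α) : IsConstructibleSet s → IsConstructibleSet t →
      IsConstructibleSet (s ∪ t)

/-- `𝓡 ⊨ DC`: every nonempty definable subset of `R` bounded above has a supremum. -/
def DCProp (L : FirstOrder.Language) (R : Type*) [L.Structure R] [Preorder R] : Prop :=
  ∀ s : Set R, IsDefinable L {v : Fin 1 → R | v 0 ∈ s} → s.Nonempty → BddAbove s →
    ∃ a : R, IsLUB s a

/-- `𝓡 ⊨ LUF₂` (locally uniform finiteness of the second kind). -/
def LUF2 (L : FirstOrder.Language) (R : Type*) [L.Structure R] [LinearOrder R]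
    [TopologicalSpace R] : Prop :=
  ∀ (m : ℕ) (X : Set (Fin (m + 1) → R)), IsDefinable L X → ∀ (a : R) (b : Fin m → R),
    ∃ N : ℕ, 0 < N ∧ ∃ p q : R, a ∈ interior (Set.Icc p q) ∧
      ∃ U : Set (Fin m → R), OpenBox U ∧ b ∈ U ∧
        ∀ x ∈ U, ∀ p' q' : R, a ∈ interior (Set.Icc p' q') → Set.Icc p' q' ⊆ Set.Icc p q →
          (fiber1 X x ∩ Set.Icc p' q').Infinite ∨ (fiber1 X x ∩ Set.Icc p' q').ncard ≤ N

/-- `𝓡 ⊨ LUF₁`: `LUF₂` with `U` always taken to be all of `R^m`. -/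
def LUF1 (L : FirstOrder.Language) (R : Type*) [L.Structure R] [LinearOrder R]
    [TopologicalSpace R] : Prop :=
  ∀ (m : ℕ) (X : Set (Fin (m + 1) → R)), IsDefinable L X → ∀ a : R,
    ∃ N : ℕ, 0 < N ∧ ∃ p q : R, a ∈ interior (Set.Icc p q) ∧
      ∀ (x : Fin m → R), ∀ p' q' : R,
        a ∈ interior (Set.Icc p' q') → Set.Icc p' q' ⊆ Set.Icc p q →
          (fiber1 X x ∩ Set.Icc p' q').Infinite ∨ (fiber1 X x ∩ Set.Icc p' q').ncard ≤ N

/-- `𝓡 ⊨ SLUF`: `LUF₁` with the interval `I` chosen independently of the definable set. -/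
def SLUF (L : FirstOrder.Language) (R : Type*) [L.Structure R] [LinearOrder R]
    [TopologicalSpace R] : Prop :=
  ∀ a : R, ∃ p q : R, a ∈ interior (Set.Icc p q) ∧
    ∀ (m : ℕ) (X : Set (Fin (m + 1) → R)), IsDefinable L X →
      ∃ N : ℕ, 0 < N ∧
        ∀ (x : Fin m → R), ∀ p' q' : R,
          a ∈ interior (Set.Icc p' q') → Set.Icc p' q' ⊆ Set.Icc p q →
            (fiber1 X x ∩ Set.Icc p' q').Infinite ∨ (fiber1 X x ∩ Set.Icc p' q').ncard ≤ N

/-- The language of the open core of `𝓡`: one `n`-ary relation symbol for each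
`𝓡`-definable open subset of `R^n`. -/
def openCoreLang (L : FirstOrder.Language) (R : Type*) [L.Structure R] [TopologicalSpace R] :
    FirstOrder.Language where
  Functions := fun _ => Empty
  Relations := fun n => { s : Set (Fin n → R) // Set.Definable (Set.univ : Set R) L s ∧ IsOpen s }

/-- The open core of `𝓡`: the structure on `R` interpreting each relation symbol by the
corresponding `𝓡`-definable open set. -/
def openCoreStructure (L : FirstOrder.Language) (R : Type*) [L.Structure R]
    [TopologicalSpace R] : (openCoreLang L R).Structure R where
  funMap := fun f _ => f.elim
  RelMap := fun s x => x ∈ s.1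

/-- A set is definable in the open core of `𝓡` if it is definable (with parameters) in the
structure generated by the `𝓡`-definable open sets. -/
def DefinableInOpenCore (L : FirstOrder.Language) (R : Type*) [L.Structure R]
    [TopologicalSpace R] {n : ℕ} (X : Set (Fin n → R)) : Prop :=
  letI := openCoreStructure L R
  Set.Definable (Set.univ : Set R) (openCoreLang L R) X

/-- The local dimension `dim_x X` of `X ⊆ R^n` at `x`, an element of `{-∞} ∪ ℕ ∪ {∞}`:
the supremum of the nonnegative integers `d` such that for every open box `B` containing
`x`, some coordinate projection of `B ∩ X` to `R^d` has nonempty interior (and `-∞` if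
some open box containing `x` misses `X`). -/
noncomputable def locDim {R : Type*} [LT R] [TopologicalSpace R] {n : ℕ}
    (X : Set (Fin n → R)) (x : Fin n → R) : WithBot ℕ∞ :=
  sSup {e : WithBot ℕ∞ | ∃ d : ℕ, e = ((d : ℕ∞) : WithBot ℕ∞) ∧
    ∀ B : Set (Fin n → R), OpenBox B → x ∈ B →
      ∃ f : Fin d → Fin n, Function.Injective f ∧
        (interior ((fun y => y ∘ f) '' (B ∩ X))).Nonempty}

/-- The dimension of `X ⊆ R^n`: the supremum of the local dimensions. -/
noncomputable def setDim {R : Type*} [LT R] [TopologicalSpace R] {n : ℕ}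
    (X : Set (Fin n → R)) : WithBot ℕ∞ :=
  ⨆ x : Fin n → R, locDim X x

/-- The projective dimension of `X ⊆ R^n`: the supremum of the nonnegative integers `d`
such that some coordinate projection of `X` to `R^d` has nonempty interior (`-∞` for the
empty set). -/
noncomputable def projDim {R : Type*} [TopologicalSpace R] {n : ℕ}
    (X : Set (Fin n → R)) : WithBot ℕ∞ :=
  sSup {e : WithBot ℕ∞ | ∃ d : ℕ, e = ((d : ℕ∞) : WithBot ℕ∞) ∧
    ∃ f : Fin d → Fin n, Function.Injective f ∧
      (interior ((fun y => y ∘ f) '' X)).Nonempty}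

/-- A subset of `R` which is a union of at most `N` open intervals. -/
def UnionAtMostOpenIntervals {R : Type*} [Preorder R] (N : ℕ) (s : Set R) : Prop :=
  ∃ Q : Finset (R × R), Q.card ≤ N ∧ s = ⋃ p ∈ Q, Set.Ioo p.1 p.2

/-- A subset of `R` which is a union of at most `N₁` points and `N₂` closed intervals. -/
def UnionAtMostPtsClosedIntervals {R : Type*} [Preorder R] (N₁ N₂ : ℕ) (s : Set R) : Prop :=
  ∃ (P : Finset R) (Q : Finset (R × R)), P.card ≤ N₁ ∧ Q.card ≤ N₂ ∧
    s = ↑P ∪ ⋃ p ∈ Q, Set.Icc p.1 p.2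

/-- A subset of `R` which is a union of at most `N₁` points and `N₂` open intervals. -/
def UnionAtMostPtsOpenIntervals {R : Type*} [Preorder R] (N₁ N₂ : ℕ) (s : Set R) : Prop :=
  ∃ (P : Finset R) (Q : Finset (R × R)), P.card ≤ N₁ ∧ Q.card ≤ N₂ ∧
    s = ↑P ∪ ⋃ p ∈ Q, Set.Ioo p.1 p.2

/-- `X ∩ B` is the graph of a continuous map defined on the coordinate-projection image
of `B` (the projection being given by the injection `f` of coordinates). -/
def IsGraphOn {R : Type*} [TopologicalSpace R] {n d : ℕ} (f : Fin d → Fin n)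
    (S : Set (Fin n → R)) (D : Set (Fin d → R)) : Prop :=
  ∃ g : (Fin d → R) → (Fin n → R), ContinuousOn g D ∧ (∀ z ∈ D, (g z) ∘ f = z) ∧ S = g '' D

end CommonDefs

universe u

section Toolkit

open FirstOrder Set Topology

/-- Contexts: types homeomorphic to a finite power of `R`. -/
class Ctx (R : Type u) [TopologicalSpace R] (Γ : Type u) [TopologicalSpace Γ] where
  idx : Type
  fin : Finite idx
  e : Γ ≃ₜ (idx → R)

instance Ctx.self (R : Type u) [TopologicalSpace R] : Ctx R R where
  idx := Unit
  fin := inferInstance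
  e := (Homeomorph.funUnique Unit R).symm

instance Ctx.pi (R : Type u) [TopologicalSpace R] (κ : Type) [Finite κ] : Ctx R (κ → R) where
  idx := κ
  fin := inferInstance
  e := Homeomorph.refl _

instance Ctx.prod (R : Type u) [TopologicalSpace R] (Γ Δ : Type u) [TopologicalSpace Γ]
    [TopologicalSpace Δ] [c : Ctx R Γ] [c' : Ctx R Δ] : Ctx R (Γ × Δ) where
  idx := c.idx ⊕ c'.idx
  fin := by have := c.fin; have := c'.fin; infer_instance
  e := (c.e.prodCongr c'.e).trans Homeomorph.sumArrowHomeomorphProdArrow.symm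

attribute [instance] Ctx.fin

variable (L : FirstOrder.Language) (R : Type u) [L.Structure R] [TopologicalSpace R]
variable {Γ Δ Θ : Type u} [TopologicalSpace Γ] [TopologicalSpace Δ] [TopologicalSpace Θ]
  [Ctx R Γ] [Ctx R Δ] [Ctx R Θ]

/-- Definable predicates on a context. -/
def DS (P : Γ → Prop) : Prop :=
  Set.Definable (Set.univ : Set R) L {v : Ctx.idx R Γ → R | P (Ctx.e.symm v)}

/-- Definable maps between contexts. -/
@[fun_prop]
def DM (t : Γ → Δ) : Prop :=
  ∀ k, Set.DefinableFun L (Set.univ : Set R)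
    (fun v : Ctx.idx R Γ → R => Ctx.e (R := R) (t (Ctx.e.symm v)) k)

variable {L R}

theorem DS.comp {P : Δ → Prop} (hP : DS L R P) {t : Γ → Δ} (ht : DM L R t) :
    DS L R (fun g => P (t g)) := by
  have := Set.Definable.preimage_map (F := fun v : Ctx.idx R Γ → R => Ctx.e (R := R) (t (Ctx.e.symm v)))
    ht hP
  unfold DS
  convert! this using 1
  ext v
  simp

theorem DS.not {P : Γ → Prop} (h : DS L R P) : DS L R (fun g => ¬ P g) :=
  Set.Definable.compl h

theorem DS.and {P Q : Γ → Prop} (h : DS L R P) (h' : DS L R Q) : DS L R (fun g => P g ∧ Q g) :=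
  Set.Definable.inter h h'

theorem DS.or {P Q : Γ → Prop} (h : DS L R P) (h' : DS L R Q) : DS L R (fun g => P g ∨ Q g) :=
  Set.Definable.union h h'

theorem DS.imp {P Q : Γ → Prop} (h : DS L R P) (h' : DS L R Q) :
    DS L R (fun g => P g → Q g) := by
  have := h.not.or h'
  convert! this using 2
  tauto

theorem DS.congr {P Q : Γ → Prop} (h : DS L R P) (h' : ∀ g, Q g ↔ P g) : DS L R Q := by
  have : Q = P := funext fun g => propext (h' g)
  rwa [this]

theorem DS.ex {P : Γ → Δ → Prop} (h : DS L R (fun p : Γ × Δ => P p.1 p.2)) :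
    DS L R (fun g => ∃ d, P g d) := by
  have := Set.Definable.exists_of_finite (α := Ctx.idx R Γ) (β := Ctx.idx R Δ) h
  unfold DS
  convert! this using 1
  ext v
  constructor
  · rintro ⟨d, hd⟩
    refine ⟨Ctx.e d, ?_⟩
    change P (Ctx.e.symm v) (Ctx.e.symm (Ctx.e d))
    simpa using hd
  · rintro ⟨u, hu⟩
    exact ⟨Ctx.e.symm u, hu⟩

theorem DS.all {P : Γ → Δ → Prop} (h : DS L R (fun p : Γ × Δ => P p.1 p.2)) :
    DS L R (fun g => ∀ d, P g d) :=
  (h.not.ex (P := fun g d => ¬ P g d)).not.congr (by intro g; push Not; rfl)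

theorem DS.fin_all {κ : Type*} [Finite κ] {P : κ → Γ → Prop} (h : ∀ k, DS L R (P k)) :
    DS L R (fun g => ∀ k, P k g) := by
  have := Set.definable_iInter_of_finite h
  unfold DS
  convert! this using 1
  ext v
  simp

theorem DS.fin_ex {κ : Type*} [Finite κ] {P : κ → Γ → Prop} (h : ∀ k, DS L R (P k)) :
    DS L R (fun g => ∃ k, P k g) :=
  (DS.fin_all (fun k => (h k).not)).not.congr (by intro g; push Not; rfl)

@[fun_prop]
theorem DM.id' : DM L R (fun g : Γ => g) := by
  intro k
  simp only [Homeomorph.apply_symm_apply]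
  exact Set.DefinableFun.proj L

@[fun_prop]
theorem DM.const' (d : Δ) : DM L R (fun _ : Γ => d) := by
  intro k
  exact L.definableFun_const _ (Set.mem_univ _)

@[fun_prop]
theorem DM.comp' {t : Δ → Θ} (ht : DM L R t) {t' : Γ → Δ} (ht' : DM L R t') :
    DM L R (fun g => t (t' g)) := by
  intro k
  have := Set.DefinableFun.comp (g := fun v : Ctx.idx R Γ → R => Ctx.e (R := R) (t' (Ctx.e.symm v)))
    ht' (ht k)
  simpa using this

theorem DM.fst0 : DM L R (fun p : Γ × Δ => p.1) := by
  intro k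
  have : (fun v : Ctx.idx R (Γ × Δ) → R => Ctx.e (R := R) (Ctx.e.symm v : Γ × Δ).1 k)
     = fun v => v (Sum.inl k) := by
    funext v
    change Ctx.e (Ctx.e.symm (v ∘ Sum.inl) : Γ) k = _
    simp
  rw [this]
  exact Set.DefinableFun.proj L

theorem DM.snd0 : DM L R (fun p : Γ × Δ => p.2) := by
  intro k
  have : (fun v : Ctx.idx R (Γ × Δ) → R => Ctx.e (R := R) (Ctx.e.symm v : Γ × Δ).2 k)
     = fun v => v (Sum.inr k) := by
    funext v
    change Ctx.e (Ctx.e.symm (v ∘ Sum.inr) : Δ) k = _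
    simp
  rw [this]
  exact Set.DefinableFun.proj L

@[fun_prop]
theorem DM.fst' {t : Γ → Δ × Θ} (ht : DM L R t) : DM L R (fun g => (t g).1) :=
  DM.comp' DM.fst0 ht

@[fun_prop]
theorem DM.snd' {t : Γ → Δ × Θ} (ht : DM L R t) : DM L R (fun g => (t g).2) :=
  DM.comp' DM.snd0 ht

@[fun_prop]
theorem DM.mk' {t : Γ → Δ} (ht : DM L R t) {t' : Γ → Θ} (ht' : DM L R t') :
    DM L R (fun g => (t g, t' g)) := by
  rintro (k | k)
  · exact ht k
  · exact ht' k

@[fun_prop]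
theorem DM.eval' {κ : Type} [Finite κ] (k : κ) : DM L R (fun v : κ → R => v k) := by
  intro _
  exact Set.DefinableFun.proj L

@[fun_prop]
theorem DM.pi' {κ : Type} [Finite κ] {t : Γ → κ → R} (ht : ∀ k, DM L R (fun g => t g k)) :
    DM L R t := by
  intro k
  exact ht k ()

theorem DM.coord (k : Ctx.idx R Γ) : DM L R (fun g : Γ => Ctx.e (R := R) g k) := by
  intro _
  change Set.DefinableFun L _ (fun v : Ctx.idx R Γ → R => Ctx.e (R := R) (Ctx.e.symm v : Γ) k)
  simp only [Homeomorph.apply_symm_apply]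
  exact Set.DefinableFun.proj L

theorem DS.eq_of {t t' : Γ → R} (ht : DM L R t) (ht' : DM L R t') :
    DS L R (fun g => t g = t' g) :=
  Set.DefinableFun.ofPred_eq (ht ()) (ht' ())

theorem DS.eq {t t' : Γ → Δ} (ht : DM L R t) (ht' : DM L R t') :
    DS L R (fun g => t g = t' g) := by
  refine (DS.fin_all (L := L) (R := R) (κ := Ctx.idx R Δ)
    (P := fun k g => Ctx.e (R := R) (t g) k = Ctx.e (R := R) (t' g) k) fun k => ?_).congr ?_
  · exact DS.eq_of (DM.comp' (DM.coord k) ht) (DM.comp' (DM.coord k) ht')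
  · intro g
    rw [← funext_iff]
    simp

/-- The standing assumptions as a class. -/
class Std (L : FirstOrder.Language) (R : Type u) [L.Structure R] [LinearOrder R] [AddCommGroup R] :
    Prop where
  lt : IsDefinable L {v : Fin 2 → R | v 0 < v 1}
  add : IsDefinable L {v : Fin 3 → R | v 0 + v 1 = v 2}

variable [LinearOrder R] [AddCommGroup R] [Std L R]

theorem DS.lt {t t' : Γ → R} (ht : DM L R t) (ht' : DM L R t') :
    DS L R (fun g => t g < t' g) := by
  have h : DS L R (fun v : Fin 2 → R => v 0 < v 1) := Std.lt (L := L)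
  have := h.comp (t := fun g => ![t g, t' g]) (by
    apply DM.pi'
    intro k
    fin_cases k
    · exact ht
    · exact ht')
  exact this

theorem DS.le {t t' : Γ → R} (ht : DM L R t) (ht' : DM L R t') :
    DS L R (fun g => t g ≤ t' g) :=
  (DS.lt ht' ht).not.congr (by simp)

theorem DM.of_graph {t : Γ → R} (h : DS L R (fun p : Γ × R => t p.1 = p.2)) : DM L R t := by
  intro k
  have := Set.Definable.preimage_comp
    (β := Option (Ctx.idx R Γ)) (fun i : Ctx.idx R Γ ⊕ Unit => i.elim some (fun _ => none)) h
  exact this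

@[fun_prop]
theorem DM.add' {t t' : Γ → R} (ht : DM L R t) (ht' : DM L R t') :
    DM L R (fun g => t g + t' g) := by
  have h : DS L R (fun v : Fin 3 → R => v 0 + v 1 = v 2) := Std.add (L := L)
  apply DM.of_graph
  have := h.comp (t := fun p : Γ × R => ![t p.1, t' p.1, p.2]) (by
    apply DM.pi'
    intro k
    fin_cases k
    · exact ht.comp' DM.fst0
    · exact ht'.comp' DM.fst0
    · exact DM.snd0)
  exact this

@[fun_prop]
theorem DM.sub' {t t' : Γ → R} (ht : DM L R t) (ht' : DM L R t') :
    DM L R (fun g => t g - t' g) := by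
  apply DM.of_graph
  refine DS.congr (P := fun p : Γ × R => t p.1 = p.2 + t' p.1) (DS.eq_of ?_ ?_) ?_
  · exact ht.comp' DM.fst0
  · exact DM.add' DM.snd0 (ht'.comp' DM.fst0)
  · intro p
    exact sub_eq_iff_eq_add

end Toolkit

section Topo

open FirstOrder Set Topology Filter

variable {L : FirstOrder.Language} {R : Type u} [L.Structure R] [TopologicalSpace R]
variable {Γ Δ Θ : Type u} [TopologicalSpace Γ] [TopologicalSpace Δ] [TopologicalSpace Θ]
  [Ctx R Γ] [Ctx R Δ] [Ctx R Θ]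
variable [LinearOrder R] [AddCommGroup R]

/-- `y` lies in the box of radius `δ` around `x`. -/
def near (x : Γ) (δ : R) (y : Γ) : Prop :=
  ∀ i, Ctx.e x i - δ < Ctx.e (R := R) y i ∧ Ctx.e y i < Ctx.e x i + δ

theorem DS.near [Std L R] {a c : Γ → Δ} {b : Γ → R} (ha : DM L R a) (hb : DM L R b)
    (hc : DM L R c) : DS L R (fun g => near (a g) (b g) (c g)) := by
  refine DS.fin_all fun k => ?_
  have h1 := DM.comp' (DM.coord (L := L) (R := R) (Γ := Δ) k) ha
  have h2 := DM.comp' (DM.coord (L := L) (R := R) (Γ := Δ) k) hc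
  exact (DS.lt (h1.sub' hb) h2).and (DS.lt h2 (h1.add' hb))

theorem near_prod {x y : Γ} {t u : Δ} {δ : R} :
    near (x, t) δ (y, u) ↔ near x δ y ∧ near t δ u := by
  constructor
  · intro h
    exact ⟨fun i => h (Sum.inl i), fun i => h (Sum.inr i)⟩
  · rintro ⟨h, h'⟩ (i | i)
    · exact h i
    · exact h' i

theorem near_self {a b δ : R} : near a δ b ↔ a - δ < b ∧ b < a + δ := by
  constructor
  · intro h
    exact h ()
  · intro h _
    exact h

variable [IsOrderedAddMonoid R]

theorem near.mono {x y : Γ} {δ δ' : R} (h : near x δ y) (hd : δ ≤ δ') : near x δ' y :=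
  fun i => ⟨lt_of_le_of_lt (sub_le_sub_left hd _) (h i).1,
    lt_of_lt_of_le (h i).2 (by gcongr)⟩

variable [DenselyOrdered R] [Nontrivial R] [OrderTopology R]

theorem near_refl (x : Γ) {δ : R} (h : 0 < δ) : near x δ x :=
  fun i => ⟨sub_lt_self _ h, lt_add_of_pos_right _ h⟩

theorem near_mem_nhds (x : Γ) {δ : R} (h : 0 < δ) : {y | near x δ y} ∈ 𝓝 x := by
  have : ∀ i, ∀ᶠ y in 𝓝 x, Ctx.e x i - δ < Ctx.e (R := R) y i ∧ Ctx.e y i < Ctx.e x i + δ := by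
    intro i
    have hc : Continuous (fun y : Γ => Ctx.e (R := R) y i) :=
      (continuous_apply i).comp Ctx.e.continuous
    exact hc.continuousAt.eventually (Ioo_mem_nhds (sub_lt_self _ h) (lt_add_of_pos_right _ h))
  exact eventually_all.2 this

theorem exists_pos_le_fin {κ : Type*} [Finite κ] (f : κ → R) (hf : ∀ k, 0 < f k) :
    ∃ δ : R, 0 < δ ∧ ∀ k, δ ≤ f k := by
  have h1 : ∀ᶠ δ in 𝓝[>] (0 : R), ∀ k, δ ≤ f k := by
    rw [eventually_all]
    intro k
    have : Iio (f k) ∈ 𝓝 (0 : R) := Iio_mem_nhds (hf k)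
    filter_upwards [nhdsWithin_le_nhds this] with a ha using le_of_lt ha
  have h2 : ∀ᶠ δ in 𝓝[>] (0 : R), 0 < δ := eventually_mem_nhdsWithin
  exact (h2.and h1).exists

theorem exists_near_of_mem_nhds {x : Γ} {U : Set Γ} (h : U ∈ 𝓝 x) :
    ∃ δ : R, 0 < δ ∧ ∀ y, near x δ y → y ∈ U := by
  have h1 : (Ctx.e (R := R) (Γ := Γ)).symm ⁻¹' U ∈ 𝓝 (Ctx.e (R := R) x) := by
    apply (Ctx.e (R := R) (Γ := Γ)).symm.continuous.continuousAt
    simpa using h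
  rw [nhds_pi, Filter.mem_pi] at h1
  obtain ⟨I, -, t, ht, hsub⟩ := h1
  have h2 : ∀ i, ∃ ε : R, 0 < ε ∧ Ioo (Ctx.e (R := R) x i - ε) (Ctx.e x i + ε) ⊆ t i := by
    intro i
    exact (nhds_basis_Ioo_pos _).mem_iff.1 (ht i)
  choose ε he hs using h2
  obtain ⟨δ, hd, hle⟩ := exists_pos_le_fin ε he
  refine ⟨δ, hd, fun y hy => ?_⟩
  have : Ctx.e (R := R) y ∈ I.pi t := by
    intro i _
    apply hs i
    have := (hy.mono (hle i)) i
    exact this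
  simpa using hsub this

/-- Definable completeness and local uniform finiteness. -/
class StdC (L : FirstOrder.Language) (R : Type u) [L.Structure R] [LinearOrder R] [AddCommGroup R]
    [TopologicalSpace R] : Prop extends Std L R where
  dc : DCProp L R
  luf : LUF2 L R

variable [StdC L R]

variable (L) in
theorem exists_lub {s : Set R} (hs : DS L R (· ∈ s)) (hne : s.Nonempty) (hb : BddAbove s) :
    ∃ a, IsLUB s a :=
  StdC.dc (L := L) s (DS.comp (Γ := Fin 1 → R) hs (t := fun v => v 0) (DM.eval' 0)) hne hb

variable (L) in
theorem exists_glb {s : Set R} (hs : DS L R (· ∈ s)) (hne : s.Nonempty) (hb : BddBelow s) :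
    ∃ a, IsGLB s a := by
  have h : DS L R (· ∈ lowerBounds s) := by
    refine DS.all (P := fun x y => y ∈ s → x ≤ y) ?_
    exact (hs.comp DM.snd0).imp (DS.le DM.fst0 DM.snd0)
  obtain ⟨a, ha⟩ := exists_lub L h hb (hne.mono (fun x hx y hy => hy hx))
  exact ⟨a, isLUB_lowerBounds.1 ha⟩

theorem exists_half {a : R} (ha : 0 < a) : ∃ b : R, 0 < b ∧ b + b < a := by
  obtain ⟨b, hb, hba⟩ := exists_between ha
  obtain ⟨c, hc, hcc⟩ := exists_pos_le_fin ![b, a - b] (by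
    intro k; fin_cases k <;> simp [hb, hba])
  have h0 := hcc 0
  have h1 := hcc 1
  simp at h0 h1
  obtain ⟨e, he, hec⟩ := exists_between hc
  exact ⟨e, he, by
    calc e + e < b + (a - b) := add_lt_add (hec.trans_le h0) (hec.trans_le h1)
      _ = a := by abel⟩

variable (L) in
/-- Projection of a closed definable set along one bounded coordinate is closed. -/
theorem proj_closed {A : Set (Γ × R)} (hA : DS L R (· ∈ A)) (hc : IsClosed A) {c e : R}
    (hb : ∀ p ∈ A, c ≤ p.2 ∧ p.2 ≤ e) : IsClosed {x | ∃ t, (x, t) ∈ A} := by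
  rw [← isOpen_compl_iff, isOpen_iff_mem_nhds]
  intro x hx
  have hx : ∀ t, (x, t) ∉ A := by simpa using hx
  set G : Set R := {t | ∃ δ : R, 0 < δ ∧ ∀ y, near x δ y → ∀ u, u ≤ t → (y, u) ∉ A} with hG
  have hGd : DS L R (· ∈ G) := by
    refine DS.ex (P := fun (t δ : R) => 0 < δ ∧ ∀ y, near x δ y → ∀ u, u ≤ t → (y, u) ∉ A) ?_
    refine (DS.lt (by fun_prop) (by fun_prop)).and (DS.all (P := fun (p : R × R) y =>
      near x p.2 y → ∀ u, u ≤ p.1 → (y, u) ∉ A) ?_)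
    refine (DS.near (by fun_prop) (by fun_prop) (by fun_prop)).imp
      (DS.all (P := fun (p : (R × R) × Γ) u => u ≤ p.1.1 → (p.2, u) ∉ A) ?_)
    refine (DS.le (by fun_prop) (by fun_prop)).imp (DS.not ?_)
    exact hA.comp (t := fun p : ((R × R) × Γ) × R => (p.1.2, p.2)) (by fun_prop)
  by_cases hbd : BddAbove G
  · exfalso
    obtain ⟨ε0, hε0⟩ := exists_gt (0 : R)
    have hne : G.Nonempty := by
      refine ⟨c - ε0, ε0, hε0, fun y _ u hu hyu => ?_⟩
      have := (hb _ hyu).1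
      exact absurd (lt_of_le_of_lt hu (sub_lt_self _ hε0)) (not_lt.2 this)
    obtain ⟨s, hs⟩ := exists_lub L hGd hne hbd
    obtain ⟨δ, hδ, hδA⟩ := exists_near_of_mem_nhds (R := R) (hc.isOpen_compl.mem_nhds (hx s))
    obtain ⟨g, hg, hgs, -⟩ := hs.exists_between (sub_lt_self s hδ)
    obtain ⟨δ', hδ', hg⟩ := hg
    obtain ⟨η, hη, hηδ⟩ := exists_between hδ
    have : s + η ∈ G := by
      refine ⟨min δ δ', lt_min hδ hδ', fun y hy u hu => ?_⟩
      by_cases hug : u ≤ g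
      · exact hg y (hy.mono (min_le_right _ _)) u hug
      · refine hδA (y, u) (near_prod.2 ⟨hy.mono (min_le_left _ _), near_self.2 ⟨?_, ?_⟩⟩)
        · exact hgs.trans (not_le.1 hug)
        · exact lt_of_le_of_lt hu (by gcongr)
    exact absurd (hs.1 this) (not_le.2 (lt_add_of_pos_right _ hη))
  · rw [not_bddAbove_iff] at hbd
    obtain ⟨t, ⟨δ, hδ, ht⟩, het⟩ := hbd e
    filter_upwards [near_mem_nhds x hδ] with y hy
    rintro ⟨u, hu⟩
    exact ht y hy u ((hb _ hu).2.trans het.le) hu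

/-- Bounded subsets of a context. -/
def BddC (R : Type u) [TopologicalSpace R] [LinearOrder R] [Ctx R Γ] (A : Set Γ) : Prop :=
  ∃ c d : R, ∀ y ∈ A, ∀ i, c ≤ Ctx.e y i ∧ Ctx.e y i ≤ d

variable (L) in
theorem proj_closed_fin (n : ℕ) : ∀ {Γ : Type u} [TopologicalSpace Γ] [Ctx R Γ]
    {A : Set (Γ × (Fin n → R))} (_ : DS L R (· ∈ A)) (_ : IsClosed A) {c e : R}
    (_ : ∀ p ∈ A, ∀ i, c ≤ p.2 i ∧ p.2 i ≤ e), IsClosed {x | ∃ t, (x, t) ∈ A} := by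
  induction n with
  | zero =>
    intro Γ _ _ A hA hc c e hb
    have : {x | ∃ t, (x, t) ∈ A} = (fun x => (x, (Fin.elim0 : Fin 0 → R))) ⁻¹' A := by
      ext x
      constructor
      · rintro ⟨t, ht⟩
        have : t = Fin.elim0 := Subsingleton.elim _ _
        subst this
        exact ht
      · intro h
        exact ⟨_, h⟩
    rw [this]
    exact hc.preimage (by fun_prop)
  | succ n ih =>
    intro Γ _ _ A hA hc c e hb
    set φ : (Γ × (Fin n → R)) × R → Γ × (Fin (n + 1) → R) :=
      fun p => (p.1.1, Fin.cons p.2 p.1.2) with hφ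
    have hφc : Continuous φ := by
      refine Continuous.prodMk (by fun_prop) ?_
      refine continuous_pi fun i => ?_
      refine Fin.cases ?_ (fun i => ?_) i
      · simp only [Fin.cons_zero]; fun_prop
      · simp only [Fin.cons_succ]; fun_prop
    have hφd : DM L R φ := by
      refine DM.mk' (by fun_prop) (DM.pi' fun i => ?_)
      refine Fin.cases ?_ (fun i => ?_) i
      · simp only [Fin.cons_zero]; fun_prop
      · simp only [Fin.cons_succ]; fun_prop
    have h1 : IsClosed {x : Γ × (Fin n → R) | ∃ t : R, (x, t) ∈ φ ⁻¹' A} := by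
      refine proj_closed L (hA.comp hφd) (hc.preimage hφc) (c := c) (e := e) ?_
      intro p hp
      simpa [hφ] using hb _ hp 0
    have h2 : IsClosed {x : Γ | ∃ y, (x, y) ∈ {x : Γ × (Fin n → R) | ∃ t : R, (x, t) ∈ φ ⁻¹' A}} := by
      refine ih (c := c) (e := e) ?_ h1 ?_
      · exact DS.ex (P := fun (x : Γ × (Fin n → R)) (t : R) => (x, t) ∈ φ ⁻¹' A) (hA.comp hφd)
      · rintro p ⟨t, ht⟩ i
        simpa [hφ] using hb _ ht i.succ
    convert h2 using 1
    ext x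
    constructor
    · rintro ⟨t, ht⟩
      refine ⟨Fin.tail t, t 0, ?_⟩
      simpa [hφ] using ht
    · rintro ⟨y, t, ht⟩
      exact ⟨_, ht⟩

/-- Image of a CBD set under a continuous definable map is closed. -/
theorem image_closed [T2Space Δ] {n : ℕ} {A : Set (Fin n → R)} (hA : DS L R (· ∈ A)) (hc : IsClosed A)
    (hb : BddC R A) {g : (Fin n → R) → Δ} (hg : Continuous g) (hgd : DM L R g) :
    IsClosed (g '' A) := by
  obtain ⟨c, e, hb⟩ := hb
  have := proj_closed_fin L n (Γ := Δ) (A := {p : Δ × (Fin n → R) | p.2 ∈ A ∧ g p.2 = p.1})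
    ((hA.comp (by fun_prop)).and (DS.eq (by fun_prop) (by fun_prop)))
    ((hc.preimage continuous_snd).inter (isClosed_eq (by fun_prop) (by fun_prop))) (c := c) (e := e)
    (fun p hp i => hb _ hp.1 i)
  exact this

end Topo

section OneDim

open FirstOrder Set Topology Filter

variable {L : FirstOrder.Language} {R : Type u} [L.Structure R] [TopologicalSpace R]
variable [LinearOrder R] [AddCommGroup R] [IsOrderedAddMonoid R] [DenselyOrdered R] [Nontrivial R]
  [OrderTopology R]

/-- `S` has at most `N` elements. -/
def AtMost (N : ℕ) (S : Set R) : Prop :=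
  ¬ ∃ v : Fin (N + 1) → R, (∀ i j, i ≠ j → v i ≠ v j) ∧ ∀ i, v i ∈ S

theorem exists_strictMono_of_infinite {S : Set R} (h : S.Infinite) (N : ℕ) :
    ∃ v : Fin N → R, StrictMono v ∧ ∀ i, v i ∈ S := by
  obtain ⟨t, ht, hc⟩ := h.exists_subset_card_eq N
  exact ⟨t.orderEmbOfFin hc, (t.orderEmbOfFin hc).strictMono,
    fun i => ht (t.orderEmbOfFin_mem hc i)⟩

theorem AtMost.finite {N : ℕ} {S : Set R} (h : AtMost N S) : S.Finite := by
  by_contra hi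
  obtain ⟨v, hv, hS⟩ := exists_strictMono_of_infinite hi (N + 1)
  exact h ⟨v, fun i j hij => hv.injective.ne hij, hS⟩

theorem AtMost.mono {N : ℕ} {S T : Set R} (h : AtMost N T) (hs : S ⊆ T) : AtMost N S := by
  rintro ⟨v, hv, hS⟩
  exact h ⟨v, hv, fun i => hs (hS i)⟩

theorem atMost_of_ncard {N : ℕ} {S : Set R} (hf : S.Finite) (h : S.ncard ≤ N) : AtMost N S := by
  rintro ⟨v, hv, hS⟩
  have hinj : Function.Injective v := fun i j hij => by
    by_contra hne
    exact hv i j hne hij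
  have h1 : (range v).ncard ≤ S.ncard := ncard_le_ncard (range_subset_iff.2 hS) hf
  have h2 : (range v).ncard = N + 1 := by
    rw [← image_univ, ncard_image_of_injective _ hinj, ncard_univ]
    simp
  omega

theorem locFin_exists {S : Set R} (h : LocFin S) (a : R) :
    ∃ ε : R, 0 < ε ∧ (S ∩ Ioo (a - ε) (a + ε)).Finite := by
  obtain ⟨U, hU, haU, hf⟩ := h a
  obtain ⟨ε, he, hs⟩ := (nhds_basis_Ioo_pos a).mem_iff.1 (hU.mem_nhds haU)
  exact ⟨ε, he, hf.subset (inter_subset_inter_right _ hs)⟩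

theorem LocFin.subset {α : Type*} [TopologicalSpace α] {S T : Set α} (h : LocFin T) (hs : S ⊆ T) :
    LocFin S := by
  intro x
  obtain ⟨U, hU, hx, hf⟩ := h x
  exact ⟨U, hU, hx, hf.subset (inter_subset_inter_left _ hs)⟩

variable [StdC L R]

variable (L) in
theorem luf' {A : R → Set R} (hA : DS L R (fun p : R × R => p.2 ∈ A p.1)) (a b : R) :
    ∃ (N : ℕ) (δ : R), 0 < δ ∧ ∀ x ∈ Ioo (b - δ) (b + δ), LocFin (A x) →
      AtMost N (A x ∩ Icc (a - δ) (a + δ)) := by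
  obtain ⟨N, -, p, q, hapq, U, ⟨c, d, rfl⟩, hbU, hU⟩ :=
    StdC.luf (L := L) (R := R) 1 {w : Fin 2 → R | w 1 ∈ A (w 0)}
      (hA.comp (t := fun w : Fin 2 → R => (w 0, w 1)) (by fun_prop)) a ![b]
  have hb0 := hbU 0
  simp at hb0
  obtain ⟨δ1, hδ1, h1⟩ := (nhds_basis_Ioo_pos a).mem_iff.1
    (isOpen_interior.mem_nhds hapq)
  obtain ⟨δ2, hδ2, h2⟩ := (nhds_basis_Ioo_pos b).mem_iff.1 (Ioo_mem_nhds hb0.1 hb0.2)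
  obtain ⟨δ, hδ, hδ12⟩ := exists_between (lt_min hδ1 hδ2)
  have hδ1' := hδ12.trans_le (min_le_left _ _)
  have hδ2' := hδ12.trans_le (min_le_right _ _)
  refine ⟨N, δ, hδ, fun x hx hlf => ?_⟩
  -- any finite intersection is small
  have key : ∀ u, 0 < u → u ≤ δ → (A x ∩ Icc (a - u) (a + u)).Finite →
      AtMost N (A x ∩ Icc (a - u) (a + u)) := by
    intro u hu huδ hfin
    have hfib : fiber1 {w : Fin 2 → R | w 1 ∈ A (w 0)} ![x] = A x := by
      ext y
      rfl
    have := hU ![x] (by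
      intro i
      have hx' := h2 (Ioo_subset_Ioo (sub_le_sub_left hδ2'.le _) (by gcongr) hx)
      have : i = 0 := Subsingleton.elim _ _
      subst this
      simpa using hx') (a - u) (a + u) (by
        rw [interior_Icc]
        exact ⟨sub_lt_self _ hu, lt_add_of_pos_right _ hu⟩) (by
        refine Subset.trans ?_ (h1.trans interior_subset)
        refine Icc_subset_Ioo ?_ ?_
        · exact sub_lt_sub_left (huδ.trans_lt hδ1') _
        · have := huδ.trans_lt hδ1'
          gcongr)
    rw [hfib] at this
    rcases this with h | h
    · exact absurd hfin h
    · exact atMost_of_ncard hfin h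
  set G : Set R := {u | AtMost N (A x ∩ Icc (a - u) (a + u))} with hG
  have hGd : DS L R (· ∈ G) := by
    refine DS.not ?_
    refine DS.ex (P := fun (u : R) (v : Fin (N + 1) → R) =>
      (∀ i j, i ≠ j → v i ≠ v j) ∧ ∀ i, v i ∈ A x ∩ Icc (a - u) (a + u)) ?_
    refine DS.and ?_ ?_
    · refine DS.fin_all fun i => DS.fin_all fun j => ?_
      by_cases hij : i = j
      · subst hij
        refine (DS.lt (L := L) (R := R) (t := fun _ => (0 : R)) (t' := fun _ => (0 : R))
          (by fun_prop) (by fun_prop)).not.congr ?_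
        simp
      · refine (DS.eq_of (L := L) (R := R) (t := fun p : R × (Fin (N + 1) → R) => p.2 i)
          (t' := fun p => p.2 j) (by fun_prop) (by fun_prop)).not.congr ?_
        simp [hij]
    · refine DS.fin_all fun i => DS.and ?_ (DS.and ?_ ?_)
      · exact hA.comp (t := fun p : R × (Fin (N + 1) → R) => (x, p.2 i)) (by fun_prop)
      · exact DS.le (t := fun p : R × (Fin (N + 1) → R) => a - p.1) (by fun_prop) (by fun_prop)
      · exact DS.le (t' := fun p : R × (Fin (N + 1) → R) => a + p.1) (by fun_prop) (by fun_prop)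
  by_contra hδG
  have hub : ∀ u ∈ G, u ≤ δ := by
    intro u hu
    by_contra! hlt
    exact hδG (hu.mono (inter_subset_inter_right _
      (Icc_subset_Icc (sub_le_sub_left hlt.le _) (by gcongr))))
  obtain ⟨ε, hε, hεf⟩ := locFin_exists hlf a
  obtain ⟨u0, hu0, hu0'⟩ := exists_between (lt_min hε hδ)
  have hu0G : u0 ∈ G := by
    refine key u0 hu0 (hu0'.trans_le (min_le_right _ _)).le (hεf.subset ?_)
    have := hu0'.trans_le (min_le_left _ _)
    exact inter_subset_inter_right _ (Icc_subset_Ioo (sub_lt_sub_left this _) (by gcongr))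
  obtain ⟨s, hs⟩ := exists_lub L hGd ⟨u0, hu0G⟩ ⟨δ, hub⟩
  have hs0 : 0 < s := hu0.trans_le (hs.1 hu0G)
  have hsδ : s ≤ δ := hs.2 hub
  obtain ⟨ε1, hε1, hf1⟩ := locFin_exists hlf (a - s)
  obtain ⟨ε2, hε2, hf2⟩ := locFin_exists hlf (a + s)
  obtain ⟨η, hη, hη12⟩ := exists_between (lt_min hε1 hε2)
  have hη1 := hη12.trans_le (min_le_left _ _)
  have hη2 := hη12.trans_le (min_le_right _ _)
  obtain ⟨g, hg, hgs, -⟩ := hs.exists_between (sub_lt_self s hη)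
  set u := min δ (s + η) with hu
  have huG : u ∈ G := by
    refine key u (lt_min hδ (add_pos hs0 hη)) (min_le_left _ _) ?_
    refine ((hg.finite.union hf1).union hf2).subset ?_
    rintro y ⟨hyA, hy1, hy2⟩
    have huη : u ≤ s + η := min_le_right _ _
    by_cases c1 : y < a - g
    · refine Or.inl (Or.inr ⟨hyA, ?_, ?_⟩)
      · calc a - s - ε1 < a - s - η := sub_lt_sub_left hη1 _
          _ = a - (s + η) := by abel
          _ ≤ a - u := sub_le_sub_left huη _
          _ ≤ y := hy1
      · calc y < a - g := c1
          _ < a - (s - η) := sub_lt_sub_left hgs _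
          _ = a - s + η := by abel
          _ < a - s + ε1 := by gcongr
    by_cases c2 : a + g < y
    · refine Or.inr ⟨hyA, ?_, ?_⟩
      · calc a + s - ε2 < a + s - η := sub_lt_sub_left hη2 _
          _ = a + (s - η) := by abel
          _ < a + g := by gcongr
          _ < y := c2
      · calc y ≤ a + u := hy2
          _ ≤ a + (s + η) := by gcongr
          _ = a + s + η := by abel
          _ < a + s + ε2 := by gcongr
    exact Or.inl (Or.inl ⟨hyA, not_lt.1 c1, not_lt.1 c2⟩)
  rcases min_choice δ (s + η) with h | h
  · rw [hu, h] at huG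
    exact hδG huG
  · rw [hu, h] at huG
    exact absurd (hs.1 huG) (not_le.2 (lt_add_of_pos_right _ hη))

/-- A closed definable subset of `R` with empty interior is locally finite. -/
theorem locFin_of_closed {A : Set R} (hA : DS L R (· ∈ A)) (hc : IsClosed A)
    (hi : interior A = ∅) : LocFin A := by
  set D : R → Set R := fun ε => {x | x ∈ A ∧ 0 < ε ∧ ∀ y, y ∈ A → x < y → x + ε ≤ y} with hD
  have hDd : DS L R (fun p : R × R => p.2 ∈ D p.1) := by
    refine DS.and (hA.comp (by fun_prop)) (DS.and (DS.lt (by fun_prop) (by fun_prop)) ?_)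
    refine DS.all (P := fun (p : R × R) y => y ∈ A → p.2 < y → p.2 + p.1 ≤ y) ?_
    exact DS.imp (hA.comp (by fun_prop)) (DS.imp (DS.lt (by fun_prop) (by fun_prop))
      (DS.le (by fun_prop) (by fun_prop)))
  have hDl : ∀ ε, LocFin (D ε) := by
    intro ε z
    by_cases hε : 0 < ε
    · obtain ⟨η, hη, hηε⟩ := exists_half hε
      refine ⟨Ioo (z - η) (z + η), isOpen_Ioo,
        ⟨sub_lt_self _ hη, lt_add_of_pos_right _ hη⟩, Set.Subsingleton.finite ?_⟩
      have aux : ∀ x ∈ D ε ∩ Ioo (z - η) (z + η), ∀ y ∈ D ε ∩ Ioo (z - η) (z + η), ¬ x < y := by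
        rintro x ⟨hx, hx1, hx2⟩ y ⟨hy, hy1, hy2⟩ hxy
        have h1 := hx.2.2 y hy.1 hxy
        have : x + ε < x + ε := by
          calc x + ε ≤ y := h1
            _ < z + η := hy2
            _ = (z - η) + (η + η) := by abel
            _ < x + ε := add_lt_add hx1 hηε
        exact lt_irrefl _ this
      intro x hx y hy
      exact le_antisymm (not_lt.1 (aux y hy x hx)) (not_lt.1 (aux x hx y hy))
    · refine ⟨univ, isOpen_univ, mem_univ _, ?_⟩
      have : D ε = ∅ := by
        ext x
        simp [hD, hε]
      simp [this]
  intro a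
  obtain ⟨N, δ, hδ, hN⟩ := luf' L hDd a 0
  refine ⟨Ioo (a - δ) (a + δ), isOpen_Ioo, ⟨sub_lt_self _ hδ, lt_add_of_pos_right _ hδ⟩, ?_⟩
  by_contra hinf
  obtain ⟨v, hv, hvA⟩ := exists_strictMono_of_infinite hinf (N + 2)
  have hgap : ∀ i : Fin (N + 1), ∃ w ε, 0 < ε ∧ w ∈ D ε ∧ v i.castSucc ≤ w ∧ w < v i.succ := by
    intro i
    have hlt : v i.castSucc < v i.succ := hv (Fin.castSucc_lt_succ)
    have : ¬ Ioo (v i.castSucc) (v i.succ) ⊆ A := by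
      intro hsub
      have h1 : Ioo (v i.castSucc) (v i.succ) ⊆ interior A := interior_maximal hsub isOpen_Ioo
      rw [hi] at h1
      obtain ⟨z, hz⟩ := exists_between hlt
      exact h1 hz
    obtain ⟨z, hz, hzA⟩ := not_subset.1 this
    obtain ⟨w, hw⟩ := exists_lub L (s := A ∩ Iic z)
      ((hA.comp (by fun_prop)).and (DS.le (by fun_prop) (by fun_prop)))
      ⟨v i.castSucc, (hvA _).1, hz.1.le⟩ ⟨z, fun y hy => hy.2⟩
    have hwA : w ∈ A ∩ Iic z :=
      hw.mem_of_isClosed ⟨v i.castSucc, (hvA _).1, hz.1.le⟩ (hc.inter isClosed_Iic)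
    have hwz : w < z := lt_of_le_of_ne hwA.2 (fun h => hzA (h ▸ hwA.1))
    refine ⟨w, z - w, sub_pos.2 hwz, ⟨hwA.1, sub_pos.2 hwz, fun y hy hwy => ?_⟩,
      hw.1 ⟨(hvA _).1, hz.1.le⟩, hwz.trans hz.2⟩
    rw [add_sub_cancel]
    by_contra! hyz
    exact absurd (hw.1 ⟨hy, hyz.le⟩) (not_le.2 hwy)
  choose w ε hε hwD hw1 hw2 using hgap
  obtain ⟨η0, hη0, hle⟩ := exists_pos_le_fin ε hε
  obtain ⟨η, hη, hηlt⟩ := exists_between (lt_min hη0 hδ)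
  refine hN η ⟨by rw [zero_sub]; exact (neg_lt_zero.2 hδ).trans hη, by
    rw [zero_add]; exact hηlt.trans_le (min_le_right _ _)⟩ (hDl η) ⟨w, ?_, ?_⟩
  · have hmono : StrictMono w := by
      intro i j hij
      calc w i < v i.succ := hw2 i
        _ ≤ v j.castSucc := hv.monotone (Fin.succ_le_castSucc_iff.2 hij)
        _ ≤ w j := hw1 j
    exact fun i j hij => hmono.injective.ne hij
  · intro i
    refine ⟨⟨(hwD i).1, hη, fun y hy hwy => ?_⟩, ?_, ?_⟩
    · refine le_trans ?_ ((hwD i).2.2 y hy hwy)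
      have := (hηlt.trans_le (min_le_left _ _)).le.trans (hle i)
      gcongr
    · exact (hvA _).2.1.le.trans (hw1 i)
    · exact (hw2 i).le.trans (hvA _).2.2.le

/-- A `D_Σ`-subset of `R` all of whose members have empty interior is locally finite. -/
theorem locFin_of_family {X : R → R → Set R} (hX : DS L R (fun p : R × R × R => p.2.2 ∈ X p.1 p.2.1))
    (hc : ∀ r s, 0 < r → 0 < s → IsClosed (X r s))
    (hr : ∀ r r' s, 0 < r → 0 < s → r ≤ r' → X r s ⊆ X r' s)
    (hs : ∀ r s s', 0 < r → 0 < s → s ≤ s' → X r s' ⊆ X r s)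
    (hi : ∀ r s, 0 < r → 0 < s → interior (X r s) = ∅) :
    LocFin {x | ∃ r s, 0 < r ∧ 0 < s ∧ x ∈ X r s} := by
  set Y : R → Set R := fun r => {x | 0 < r ∧ ∃ s, 0 < s ∧ x ∈ X r s} with hY
  have hYd : DS L R (fun p : R × R => p.2 ∈ Y p.1) := by
    refine DS.and (DS.lt (by fun_prop) (by fun_prop)) ?_
    refine DS.ex (P := fun (p : R × R) (s : R) => 0 < s ∧ p.2 ∈ X p.1 s) ?_
    refine DS.and (DS.lt (by fun_prop) (by fun_prop)) ?_
    exact hX.comp (t := fun p : (R × R) × R => (p.1.1, p.2, p.1.2)) (by fun_prop)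
  have hYm : ∀ r r', r ≤ r' → Y r ⊆ Y r' := by
    rintro r r' hrr x ⟨h0, s, h1, h2⟩
    exact ⟨h0.trans_le hrr, s, h1, hr r r' s h0 h1 hrr h2⟩
  -- each `Y r` is locally finite
  have hYl : ∀ r, LocFin (Y r) := by
    intro r a
    by_cases hr0 : 0 < r
    · have hAd : DS L R (fun p : R × R => p.2 ∈ {x | 0 < p.1 ∧ x ∈ X r p.1}) := by
        refine DS.and (DS.lt (by fun_prop) (by fun_prop)) ?_
        exact hX.comp (t := fun p : R × R => (r, p.1, p.2)) (by fun_prop)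
      obtain ⟨N, δ, hδ, hN⟩ := luf' L (A := fun s => {x | 0 < s ∧ x ∈ X r s}) hAd a 0
      refine ⟨Ioo (a - δ) (a + δ), isOpen_Ioo,
        ⟨sub_lt_self _ hδ, lt_add_of_pos_right _ hδ⟩, AtMost.finite (N := N) ?_⟩
      rintro ⟨v, hv, hvY⟩
      have : ∀ i, ∃ s, 0 < s ∧ v i ∈ X r s := fun i => (hvY i).1.2
      choose s hs0 hsX using this
      obtain ⟨η0, hη0, hle⟩ := exists_pos_le_fin s hs0
      obtain ⟨η, hη, hηlt⟩ := exists_between (lt_min hη0 hδ)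
      refine hN η ⟨by rw [zero_sub]; exact (neg_lt_zero.2 hδ).trans hη, by
        rw [zero_add]; exact hηlt.trans_le (min_le_right _ _)⟩ ?_ ⟨v, hv, fun i => ?_⟩
      · have hl : LocFin (X r η) := locFin_of_closed
          (hX.comp (t := fun x : R => (r, η, x)) (by fun_prop)) (hc r η hr0 hη) (hi r η hr0 hη)
        exact hl.subset (fun x hx => hx.2)
      · refine ⟨⟨hη, hs r η (s i) hr0 hη ?_ (hsX i)⟩, Ioo_subset_Icc_self (hvY i).2⟩
        exact (hηlt.trans_le (min_le_left _ _)).le.trans (hle i)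
    · refine ⟨univ, isOpen_univ, mem_univ _, ?_⟩
      have : Y r = ∅ := by
        ext x
        simp [hY, hr0]
      simp [this]
  set A : R → Set R := fun y => {x | (∃ r, y ∈ Y r) ∧ ∀ r, y ∈ Y r → x ∈ Y r} with hA
  have hAd : DS L R (fun p : R × R => p.2 ∈ A p.1) := by
    refine DS.and ?_ ?_
    · exact DS.ex (P := fun (p : R × R) (r : R) => p.1 ∈ Y r)
        (hYd.comp (t := fun p : (R × R) × R => (p.2, p.1.1)) (by fun_prop))
    · exact DS.all (P := fun (p : R × R) (r : R) => p.1 ∈ Y r → p.2 ∈ Y r)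
        ((hYd.comp (t := fun p : (R × R) × R => (p.2, p.1.1)) (by fun_prop)).imp
          (hYd.comp (t := fun p : (R × R) × R => (p.2, p.1.2)) (by fun_prop)))
  intro a
  obtain ⟨N, δ, hδ, hN⟩ := luf' L hAd a a
  refine ⟨Ioo (a - δ) (a + δ), isOpen_Ioo,
    ⟨sub_lt_self _ hδ, lt_add_of_pos_right _ hδ⟩, AtMost.finite (N := N) ?_⟩
  rintro ⟨v, hv, hvX⟩
  have hvY : ∀ i, ∃ r, v i ∈ Y r := by
    intro i
    obtain ⟨r, s, h1, h2, h3⟩ := (hvX i).1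
    exact ⟨r, h1, s, h2, h3⟩
  have htot : ∀ x y, (∀ r, y ∈ Y r → x ∈ Y r) ∨ (∀ r, x ∈ Y r → y ∈ Y r) := by
    intro x y
    by_contra! h
    obtain ⟨⟨r, h1, h2⟩, ⟨r', h3, h4⟩⟩ := h
    rcases le_total r r' with h | h
    · exact h4 (hYm _ _ h h1)
    · exact h2 (hYm _ _ h h3)
  have hmax : ∀ F : Finset (Fin (N + 1)), F.Nonempty →
      ∃ i ∈ F, ∀ j ∈ F, ∀ r, v i ∈ Y r → v j ∈ Y r := by
    intro F hF
    induction hF using Finset.Nonempty.cons_induction with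
    | singleton i => exact ⟨i, by simp, by simp⟩
    | cons k F hk hF ih =>
      obtain ⟨i, hiF, hi⟩ := ih
      rcases htot (v k) (v i) with h | h
      · refine ⟨i, by simp [hiF], ?_⟩
        intro j hj
        rcases Finset.mem_cons.1 hj with rfl | hj
        · exact h
        · exact hi j hj
      · refine ⟨k, by simp, ?_⟩
        intro j hj
        rcases Finset.mem_cons.1 hj with rfl | hj
        · exact fun r hr => hr
        · exact fun r hr => hi j hj r (h r hr)
  obtain ⟨i, -, hmx⟩ := hmax Finset.univ Finset.univ_nonempty
  obtain ⟨r, hvr⟩ := hvY i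
  refine hN (v i) (hvX i).2 ((hYl r).subset fun x hx => hx.2 r hvr) ⟨v, hv, fun j => ?_⟩
  exact ⟨⟨⟨r, hvr⟩, hmx j (Finset.mem_univ _)⟩, Ioo_subset_Icc_self (hvX j).2⟩

end OneDim

section Baire

open FirstOrder Set Topology Filter

variable {L : FirstOrder.Language} {R : Type u} [L.Structure R] [TopologicalSpace R]
variable [LinearOrder R] [AddCommGroup R] [IsOrderedAddMonoid R] [DenselyOrdered R] [Nontrivial R]
  [OrderTopology R]
variable {Γ Δ : Type u} [TopologicalSpace Γ] [Ctx R Γ] [TopologicalSpace Δ] [Ctx R Δ]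

/-- Pairs `(x, t)` such that `{x} × [t, t + s] ⊆ Y`. -/
def seg (Y : Set (Γ × R)) (s : R) : Set (Γ × R) :=
  {p | ∀ v, 0 ≤ v ∧ v ≤ s → (p.1, p.2 + v) ∈ Y}

/-- Points `x` whose fiber in `Y` contains an interval of length `s`. -/
def base (Y : Set (Γ × R)) (s : R) : Set Γ := {x | ∃ t, (x, t) ∈ seg Y s}

theorem seg_closed {Y : Set (Γ × R)} (hc : IsClosed Y) (s : R) : IsClosed (seg Y s) := by
  have : seg Y s = ⋂ (v : R) (_ : 0 ≤ v ∧ v ≤ s), (fun p : Γ × R => (p.1, p.2 + v)) ⁻¹' Y := by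
    ext p
    simp [seg]
  rw [this]
  exact isClosed_iInter fun v => isClosed_iInter fun _ => hc.preimage (by fun_prop)

variable [StdC L R]

theorem seg_ds {Y : Set (Γ × R)} (hY : DS L R (· ∈ Y)) (s : R) : DS L R (· ∈ seg Y s) := by
  refine DS.all (P := fun (p : Γ × R) (v : R) => 0 ≤ v ∧ v ≤ s → (p.1, p.2 + v) ∈ Y) ?_
  refine DS.imp (DS.and (DS.le (by fun_prop) (by fun_prop)) (DS.le (by fun_prop) (by fun_prop))) ?_
  exact hY.comp (t := fun p : (Γ × R) × R => (p.1.1, p.1.2 + p.2)) (by fun_prop)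

theorem seg_sub {Y : Set (Γ × R)} {s : R} (hs : 0 ≤ s) : seg Y s ⊆ Y := by
  intro p hp
  have := hp 0 ⟨le_rfl, hs⟩
  simpa using this

variable (L) in
theorem base_closed {Y : Set (Γ × R)} (hY : DS L R (· ∈ Y)) (hc : IsClosed Y) {c e : R}
    (hb : ∀ p ∈ Y, c ≤ p.2 ∧ p.2 ≤ e) {s : R} (hs : 0 ≤ s) : IsClosed (base Y s) :=
  proj_closed L (seg_ds hY s) (seg_closed hc s) (fun p hp => hb p (seg_sub hs hp))

theorem ds_interior_nonempty {C : Δ → Set Γ} (hC : DS L R (fun p : Δ × Γ => p.2 ∈ C p.1)) :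
    DS L R (fun d => (interior (C d)).Nonempty) := by
  have h : DS L R (fun d => ∃ x : Γ, ∃ δ : R, 0 < δ ∧ ∀ y, near x δ y → y ∈ C d) := by
    refine DS.ex (P := fun d (x : Γ) => ∃ δ : R, 0 < δ ∧ ∀ y, near x δ y → y ∈ C d) ?_
    refine DS.ex (P := fun (p : Δ × Γ) (δ : R) => 0 < δ ∧ ∀ y, near p.2 δ y → y ∈ C p.1) ?_
    refine DS.and (DS.lt (by fun_prop) (by fun_prop)) ?_
    refine DS.all (P := fun (p : (Δ × Γ) × R) (y : Γ) => near p.1.2 p.2 y → y ∈ C p.1.1) ?_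
    refine DS.imp (DS.near (by fun_prop) (by fun_prop) (by fun_prop)) ?_
    exact hC.comp (t := fun p : ((Δ × Γ) × R) × Γ => (p.1.1.1, p.2)) (by fun_prop)
  refine h.congr fun d => ?_
  constructor
  · rintro ⟨x, hx⟩
    exact ⟨x, exists_near_of_mem_nhds (mem_interior_iff_mem_nhds.1 hx)⟩
  · rintro ⟨x, δ, hδ, hx⟩
    exact ⟨x, mem_interior_iff_mem_nhds.2 (mem_of_superset (near_mem_nhds x hδ) hx)⟩

variable (L) in
/-- If the fibers contain intervals of length `s` over an open set, then the set has interior. -/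
theorem interior_of_base {Y : Set (Γ × R)} (hY : DS L R (· ∈ Y)) (hc : IsClosed Y) {c e : R}
    (hb : ∀ p ∈ Y, c ≤ p.2 ∧ p.2 ≤ e) {s : R} (hs : 0 < s) (hi : (interior (base Y s)).Nonempty) :
    (interior Y).Nonempty := by
  set C : R → Set Γ := fun k => {x | ∃ t, (x, t) ∈ {p : Γ × R | p ∈ seg Y s ∧ p.2 ≤ k}} with hC
  have hCd : DS L R (fun p : R × Γ => p.2 ∈ C p.1) := by
    refine DS.ex (P := fun (p : R × Γ) (t : R) => (p.2, t) ∈ seg Y s ∧ t ≤ p.1) ?_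
    refine DS.and ?_ (DS.le (by fun_prop) (by fun_prop))
    exact (seg_ds hY s).comp (t := fun p : (R × Γ) × R => (p.1.2, p.2)) (by fun_prop)
  have hCc : ∀ k, IsClosed (C k) := by
    intro k
    refine proj_closed L (c := c) (e := e) ?_ ?_ ?_
    · exact (seg_ds hY s).and (DS.le (by fun_prop) (by fun_prop))
    · exact (seg_closed hc s).inter (isClosed_le continuous_snd continuous_const)
    · intro p hp
      exact hb p (seg_sub hs.le hp.1)
  have hCe : base Y s ⊆ C e := by
    rintro x ⟨t, ht⟩
    exact ⟨t, ht, (hb _ (seg_sub hs.le ht)).2⟩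
  have hlow : ∀ k, (interior (C k)).Nonempty → c ≤ k := by
    rintro k ⟨x, hx⟩
    obtain ⟨t, ht, htk⟩ := interior_subset hx
    exact (hb _ (seg_sub hs.le ht)).1.trans htk
  obtain ⟨k, hk⟩ := exists_glb L (s := {k | (interior (C k)).Nonempty})
    (ds_interior_nonempty hCd) ⟨e, hi.mono (interior_mono hCe)⟩ ⟨c, hlow⟩
  obtain ⟨h, hh, hhs⟩ := exists_half hs
  obtain ⟨η, hη, hηh⟩ := exists_half hh
  -- pick a level above the infimum
  obtain ⟨k', hk', -, hk'lt⟩ := hk.exists_between (lt_add_of_pos_right k hη)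
  have hempty : interior (C (k - η)) = ∅ := by
    by_contra hne
    have := hk.1 (nonempty_iff_ne_empty.2 hne : (interior (C (k - η))).Nonempty)
    exact absurd this (not_le.2 (sub_lt_self _ hη))
  have hW : (interior (C k') \ C (k - η)).Nonempty := by
    by_contra hne
    rw [not_nonempty_iff_eq_empty, sdiff_eq_empty] at hne
    have := interior_maximal hne isOpen_interior
    rw [hempty] at this
    obtain ⟨x, hx⟩ := hk'
    exact this hx
  have hWo : IsOpen (interior (C k') \ C (k - η)) := isOpen_interior.sdiff (hCc _)
  obtain ⟨x, hx⟩ := hW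
  have hsub : (interior (C k') \ C (k - η)) ×ˢ Ioo (k + η) (k + h) ⊆ Y := by
    rintro ⟨y, u⟩ ⟨⟨hy1, hy2⟩, hu1, hu2⟩
    obtain ⟨t, ht, htk⟩ := interior_subset hy1
    have ht2 : k - η < t := by
      by_contra! hle
      exact hy2 ⟨t, ht, hle⟩
    have := ht (u - t) ⟨sub_nonneg.2 ((htk.trans hk'lt.le).trans hu1.le), by
      calc u - t ≤ (k + h) - (k - η) := by
            exact sub_le_sub hu2.le ht2.le
        _ = h + η := by abel
        _ ≤ h + (η + η) := by gcongr; exact le_add_of_nonneg_left hη.le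
        _ ≤ h + h := by gcongr
        _ ≤ s := hhs.le⟩
    simpa using this
  have hηh' : η < h := lt_trans (lt_add_of_pos_left _ hη) hηh
  obtain ⟨u, hu⟩ : (Ioo (k + η) (k + h)).Nonempty := nonempty_Ioo.2 (by gcongr)
  exact ⟨(x, u), interior_maximal hsub (hWo.prod isOpen_Ioo) ⟨hx, hu⟩⟩

variable (L) in
/-- `D_Σ`-families on a context. -/
structure FamC (X : R → R → Set Γ) : Prop where
  ds : DS L R (fun p : R × R × Γ => p.2.2 ∈ X p.1 p.2.1)
  closed : ∀ r s, 0 < r → 0 < s → IsClosed (X r s)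
  bdd : ∀ r s, 0 < r → 0 < s → BddC R (X r s)
  mono_r : ∀ r r' s, 0 < r → 0 < s → r ≤ r' → X r s ⊆ X r' s
  mono_s : ∀ r s s', 0 < r → 0 < s → s ≤ s' → X r s' ⊆ X r s

/-- The union of a family. -/
def fUnion (X : R → R → Set Γ) : Set Γ := {x | ∃ r s, 0 < r ∧ 0 < s ∧ x ∈ X r s}

theorem FamC.ds1 {X : R → R → Set Γ} (h : FamC L X) (r s : R) : DS L R (· ∈ X r s) :=
  h.ds.comp (t := fun x : Γ => (r, s, x)) (by fun_prop)

theorem FamC.bdd_snd {X : R → R → Set (Γ × R)} (h : FamC L X) {r s : R} (hr : 0 < r) (hs : 0 < s) :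
    ∃ c e : R, ∀ p ∈ X r s, c ≤ p.2 ∧ p.2 ≤ e := by
  obtain ⟨c, e, hb⟩ := h.bdd r s hr hs
  exact ⟨c, e, fun p hp => hb p hp (Sum.inr ())⟩

theorem base_mono {Y Y' : Set (Γ × R)} {s s' : R} (hY : Y ⊆ Y') (hs : s ≤ s') :
    base Y s' ⊆ base Y' s := by
  rintro x ⟨t, ht⟩
  exact ⟨t, fun v hv => hY (ht v ⟨hv.1, hv.2.trans hs⟩)⟩

theorem FamC.base {X : R → R → Set (Γ × R)} (h : FamC L X) :
    FamC L (fun r s => base (X r s) s) where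
  ds := by
    refine DS.ex (P := fun (p : R × R × Γ) (t : R) => (p.2.2, t) ∈ seg (X p.1 p.2.1) p.2.1) ?_
    refine DS.all (P := fun (p : (R × R × Γ) × R) (v : R) => 0 ≤ v ∧ v ≤ p.1.2.1 →
      (p.1.2.2, p.2 + v) ∈ X p.1.1 p.1.2.1) ?_
    refine DS.imp (DS.and (DS.le (by fun_prop) (by fun_prop)) (DS.le (by fun_prop) (by fun_prop))) ?_
    exact h.ds.comp (t := fun p : ((R × R × Γ) × R) × R =>
      (p.1.1.1, p.1.1.2.1, (p.1.1.2.2, p.1.2 + p.2))) (by fun_prop)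
  closed := by
    intro r s hr hs
    obtain ⟨c, e, hb⟩ := h.bdd_snd hr hs
    exact base_closed L (h.ds1 r s) (h.closed r s hr hs) hb hs.le
  bdd := by
    intro r s hr hs
    obtain ⟨c, e, hb⟩ := h.bdd r s hr hs
    refine ⟨c, e, ?_⟩
    rintro x ⟨t, ht⟩ i
    exact hb _ (seg_sub hs.le ht) (Sum.inl i)
  mono_r := fun r r' s hr hs hrr => base_mono (h.mono_r r r' s hr hs hrr) le_rfl
  mono_s := fun r s s' hr hs hss => base_mono (h.mono_s r s s' hr hs hss) hss

/-- Fiber dichotomy: a point outside the union of the bases has locally finite fiber. -/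
theorem FamC.fiber_locFin {X : R → R → Set (Γ × R)} (h : FamC L X) {x : Γ}
    (hx : x ∉ fUnion (fun r s => _root_.base (X r s) s)) :
    LocFin {t | (x, t) ∈ fUnion X} := by
  refine locFin_of_family (L := L) (X := fun r s => {t | (x, t) ∈ X r s}) ?_ ?_ ?_ ?_ ?_
  · exact h.ds.comp (t := fun p : R × R × R => (p.1, p.2.1, (x, p.2.2))) (by fun_prop)
  · intro r s hr hs
    exact (h.closed r s hr hs).preimage (by fun_prop : Continuous fun t : R => (x, t))
  · exact fun r r' s hr hs hrr t ht => h.mono_r r r' s hr hs hrr ht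
  · exact fun r s s' hr hs hss t ht => h.mono_s r s s' hr hs hss ht
  · intro r s hr hs
    by_contra hne
    obtain ⟨t, ht⟩ := nonempty_iff_ne_empty.2 hne
    obtain ⟨ε, hε, hεs⟩ := (nhds_basis_Ioo_pos t).mem_iff.1 (mem_interior_iff_mem_nhds.1 ht)
    obtain ⟨η, hη, hηlt⟩ := exists_between (lt_min hε hs)
    refine hx ⟨r, η, hr, hη, t, fun v hv => ?_⟩
    refine h.mono_s r η s hr hη (hηlt.trans_le (min_le_right _ _)).le (hεs ⟨?_, ?_⟩)
    · exact (sub_lt_self _ hε).trans_le (le_add_of_nonneg_right hv.1)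
    · have := hv.2.trans_lt (hηlt.trans_le (min_le_left _ _))
      change t + v < t + ε
      gcongr

theorem not_locFin_of_interior {S : Set R} (h : (interior S).Nonempty) : ¬ LocFin S := by
  intro hl
  obtain ⟨x, hx⟩ := h
  obtain ⟨U, hU, hxU, hf⟩ := hl x
  obtain ⟨ε, hε, hs⟩ := (nhds_basis_Ioo_pos x).mem_iff.1
    ((isOpen_interior.inter hU).mem_nhds ⟨hx, hxU⟩)
  have : (Ioo (x - ε) (x + ε)).Infinite :=
    Ioo_infinite ((sub_lt_self _ hε).trans (lt_add_of_pos_right _ hε))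
  exact this (hf.subset fun y hy => ⟨interior_subset (hs hy).1, (hs hy).2⟩)

variable (L R) in
/-- Definable Baire property for `D_Σ`-families on a context. -/
def BaireC (Γ : Type u) [TopologicalSpace Γ] [Ctx R Γ] : Prop :=
  ∀ X : R → R → Set Γ, FamC L X → (interior (fUnion X)).Nonempty →
    ∃ r s, 0 < r ∧ 0 < s ∧ (interior (X r s)).Nonempty

theorem BaireC.prod (h : BaireC L R Γ) : BaireC L R (Γ × R) := by
  intro X hX hi
  obtain ⟨⟨x, t⟩, hxt⟩ := hi
  obtain ⟨U, V, hU, hV, hxU, htV, hUV⟩ := isOpen_prod_iff.1 isOpen_interior x t hxt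
  have hsub : U ⊆ fUnion (fun r s => base (X r s) s) := by
    intro y hy
    by_contra hny
    refine not_locFin_of_interior ?_ (hX.fiber_locFin hny)
    have hVs : V ⊆ {t | (y, t) ∈ fUnion X} := by
      intro u hu
      have h1 : (y, u) ∈ interior (fUnion X) := hUV (show (y, u) ∈ U ×ˢ V from ⟨hy, hu⟩)
      have h2 : (y, u) ∈ fUnion X := interior_subset h1
      exact h2
    exact ⟨t, interior_maximal hVs hV htV⟩
  obtain ⟨r, s, hr, hs, hne⟩ := h _ hX.base ⟨x, interior_maximal hsub hU hxU⟩
  obtain ⟨c, e, hb⟩ := hX.bdd_snd hr hs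
  exact ⟨r, s, hr, hs, interior_of_base L (hX.ds1 r s) (hX.closed r s hr hs) hb hs hne⟩

theorem BaireC.fin (n : ℕ) : BaireC L R (Fin n → R) := by
  induction n with
  | zero =>
    rintro X hX ⟨x, hx⟩
    obtain ⟨r, s, hr, hs, hxX⟩ := interior_subset hx
    refine ⟨r, s, hr, hs, x, ?_⟩
    have : X r s = univ := by
      ext y
      simp [Subsingleton.elim y x, hxX]
    simp [this]
  | succ n ih =>
    intro X hX hi
    set φ : (Fin n → R) × R → (Fin (n + 1) → R) := fun p => Fin.cons p.2 p.1 with hφ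
    set ψ : (Fin (n + 1) → R) → (Fin n → R) × R := fun v => (fun i => v i.succ, v 0) with hψ
    have hφc : Continuous φ := by
      refine continuous_pi fun i => ?_
      refine Fin.cases ?_ (fun i => ?_) i
      · simp only [hφ, Fin.cons_zero]; fun_prop
      · simp only [hφ, Fin.cons_succ]; fun_prop
    have hψc : Continuous ψ := by fun_prop
    have hφψ : ∀ v, φ (ψ v) = v := by
      intro v
      funext i
      refine Fin.cases ?_ (fun i => ?_) i <;> simp [hφ, hψ]
    have hψφ : ∀ v, ψ (φ v) = v := by
      rintro ⟨v, t⟩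
      simp [hφ, hψ]
    have hφd : DM L R φ := by
      refine DM.pi' fun i => ?_
      refine Fin.cases ?_ (fun i => ?_) i
      · simp only [hφ, Fin.cons_zero]; fun_prop
      · simp only [hφ, Fin.cons_succ]; fun_prop
    have hfam : FamC L (fun r s => φ ⁻¹' X r s) := by
      refine ⟨?_, ?_, ?_, ?_, ?_⟩
      · exact hX.ds.comp (t := fun p : R × R × ((Fin n → R) × R) => (p.1, p.2.1, φ p.2.2))
          (by fun_prop)
      · exact fun r s hr hs => (hX.closed r s hr hs).preimage hφc
      · intro r s hr hs
        obtain ⟨c, e, hb⟩ := hX.bdd r s hr hs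
        refine ⟨c, e, ?_⟩
        rintro p hp (i | i)
        · have := hb _ hp i.succ
          exact this
        · have := hb _ hp (0 : Fin (n + 1))
          exact this
      · exact fun r r' s hr hs hrr => preimage_mono (hX.mono_r r r' s hr hs hrr)
      · exact fun r s s' hr hs hss => preimage_mono (hX.mono_s r s s' hr hs hss)
    obtain ⟨x, hx⟩ := hi
    have hU : fUnion (fun r s => φ ⁻¹' X r s) = φ ⁻¹' fUnion X := rfl
    obtain ⟨r, s, hr, hs, y, hy⟩ := ih.prod _ hfam ⟨ψ x, by
      rw [hU]
      refine interior_maximal (preimage_mono interior_subset) (isOpen_interior.preimage hφc) ?_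
      simpa [hφψ] using hx⟩
    refine ⟨r, s, hr, hs, φ y, ?_⟩
    refine interior_maximal (s := X r s) (t := ψ ⁻¹' interior (φ ⁻¹' X r s)) ?_
      (isOpen_interior.preimage hψc) ?_
    · intro z hz
      have := interior_subset hz
      simpa [hφψ] using this
    · simpa [hψφ] using hy

end Baire

section Main

open FirstOrder Set Topology Filter

variable {L : FirstOrder.Language} {R : Type u} [L.Structure R] [TopologicalSpace R]
variable [LinearOrder R] [AddCommGroup R] [IsOrderedAddMonoid R] [DenselyOrdered R] [Nontrivial R]
  [OrderTopology R]
variable [StdC L R]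

theorem famC_of_dSigma {n : ℕ} {F : Set (Fin (2 + n) → R)} (hF : IsDSigmaFamily L F) :
    FamC L (fun r s => famFiber F r s) := by
  obtain ⟨h1, h2, h3, h4⟩ := hF
  refine ⟨?_, fun r s hr hs => (h2 r s hr hs).2.1, fun r s hr hs => (h2 r s hr hs).2.2, h3, h4⟩
  have h1' : DS L R (· ∈ F) := h1
  refine h1'.comp (t := fun p : R × R × (Fin n → R) => (Fin.append ![p.1, p.2.1] p.2.2 : _ → R)) ?_
  refine DM.pi' fun i => ?_
  refine Fin.addCases (fun i => ?_) (fun i => ?_) i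
  · simp only [Fin.append_left]
    fin_cases i
    · change DM L R fun p : R × R × (Fin n → R) => p.1
      fun_prop
    · change DM L R fun p : R × R × (Fin n → R) => p.2.1
      fun_prop
  · simp only [Fin.append_right]
    fun_prop

theorem dSigma_of_famC {n : ℕ} {Z : R → R → Set (Fin n → R)} (hZ : FamC L Z) :
    IsDSigma L (fUnion Z) := by
  set F : Set (Fin (2 + n) → R) :=
    {w | (fun i : Fin n => w (Fin.natAdd 2 i)) ∈ Z (w (Fin.castAdd n 0)) (w (Fin.castAdd n 1))}
    with hFdef
  have hfib : ∀ r s, famFiber F r s = Z r s := by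
    intro r s
    ext y
    simp only [famFiber, hFdef, mem_ofPred_eq, Fin.append_left, Fin.append_right]
    rfl
  refine ⟨F, ⟨?_, ?_, ?_, ?_⟩, ?_⟩
  · change DS L R (· ∈ F)
    exact hZ.ds.comp (t := fun w : Fin (2 + n) → R =>
      (w (Fin.castAdd n 0), w (Fin.castAdd n 1), fun i : Fin n => w (Fin.natAdd 2 i))) (by fun_prop)
  · intro r s hr hs
    rw [hfib]
    exact ⟨hZ.ds1 r s, hZ.closed r s hr hs, hZ.bdd r s hr hs⟩
  · simpa only [hfib] using hZ.mono_r
  · simpa only [hfib] using hZ.mono_s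
  · ext x
    simp only [hfib, fUnion, mem_iUnion, mem_ofPred_eq]
    constructor
    · rintro ⟨r, s, hr, hs, hx⟩
      exact ⟨r, hr, s, hs, hx⟩
    · rintro ⟨r, hr, s, hs, hx⟩
      exact ⟨r, s, hr, hs, hx⟩

/-- Projection to the chosen coordinates together with coordinate `j`. -/
def prj {n d : ℕ} (f : Fin d → Fin n) (j : Fin n) (y : Fin n → R) : (Fin d → R) × R :=
  (fun i => y (f i), y j)

theorem famC_prj {n d : ℕ} (f : Fin d → Fin n) (j : Fin n) {X : R → R → Set (Fin n → R)}
    (hX : FamC L X) : FamC L (fun r s => prj f j '' X r s) := by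
  have hgd : DM L R (prj (R := R) f j) := by
    change DM L R (fun y : Fin n → R => ((fun i => y (f i), y j) : (Fin d → R) × R))
    fun_prop
  have hgc : Continuous (prj (R := R) f j) := by
    change Continuous (fun y : Fin n → R => ((fun i => y (f i), y j) : (Fin d → R) × R))
    fun_prop
  refine ⟨?_, ?_, ?_, ?_, ?_⟩
  · refine DS.ex (P := fun (p : R × R × ((Fin d → R) × R)) (y : Fin n → R) =>
      y ∈ X p.1 p.2.1 ∧ prj f j y = p.2.2) ?_
    refine DS.and ?_ (DS.eq (by fun_prop) (by fun_prop))
    exact hX.ds.comp (t := fun p : (R × R × ((Fin d → R) × R)) × (Fin n → R) =>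
      (p.1.1, p.1.2.1, p.2)) (by fun_prop)
  · intro r s hr hs
    exact image_closed (hX.ds1 r s) (hX.closed r s hr hs) (hX.bdd r s hr hs) hgc hgd
  · intro r s hr hs
    obtain ⟨c, e, hb⟩ := hX.bdd r s hr hs
    refine ⟨c, e, ?_⟩
    rintro _ ⟨y, hy, rfl⟩ (i | i)
    · exact hb y hy (f i)
    · exact hb y hy j
  · exact fun r r' s hr hs hrr => image_mono (hX.mono_r r r' s hr hs hrr)
  · exact fun r s s' hr hs hss => image_mono (hX.mono_s r s s' hr hs hss)

/-- The family defining the exceptional set. -/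
def excFam {n d : ℕ} (f : Fin d → Fin n) (X : R → R → Set (Fin n → R)) (r s : R) :
    Set (Fin d → R) :=
  {x | ∃ j : Fin n, x ∈ base (prj f j '' X r s) s}

theorem famC_exc {n d : ℕ} (f : Fin d → Fin n) {X : R → R → Set (Fin n → R)}
    (hX : FamC L X) : FamC L (excFam f X) := by
  refine ⟨?_, ?_, ?_, ?_, ?_⟩
  · exact DS.fin_ex fun j => (famC_prj f j hX).base.ds
  · intro r s hr hs
    have : excFam f X r s = ⋃ j, base (prj f j '' X r s) s := by
      ext x
      simp [excFam]
    rw [this]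
    exact isClosed_iUnion_of_finite fun j => (famC_prj f j hX).base.closed r s hr hs
  · intro r s hr hs
    obtain ⟨c, e, hb⟩ := hX.bdd r s hr hs
    refine ⟨c, e, ?_⟩
    rintro x ⟨j, t, ht⟩ i
    obtain ⟨y, hy, hyx⟩ := seg_sub hs.le ht
    have hx : x = fun i => y (f i) := (congrArg Prod.fst hyx).symm
    subst hx
    exact hb y hy (f i)
  · rintro r r' s hr hs hrr x ⟨j, hx⟩
    exact ⟨j, (famC_prj f j hX).base.mono_r r r' s hr hs hrr hx⟩
  · rintro r s s' hr hs hss x ⟨j, hx⟩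
    exact ⟨j, (famC_prj f j hX).base.mono_s r s s' hr hs hss hx⟩

theorem exists_interior_of_iUnion {α ι : Type*} [TopologicalSpace α] [Finite ι] {C : ι → Set α}
    (hc : ∀ i, IsClosed (C i)) (hi : (interior (⋃ i, C i)).Nonempty) :
    ∃ i, (interior (C i)).Nonempty := by
  by_contra! h
  have key : ∀ s : Set ι, s.Finite → interior (⋃ i ∈ s, C i) = ∅ := by
    intro s hs
    induction s, hs using Set.Finite.induction_on with
    | empty => simp
    | insert _ hs ih =>
      rw [biUnion_insert, interior_union_isClosed_of_interior_empty (hc _) ih]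
      exact h _
  have := key univ finite_univ
  simp only [mem_univ, iUnion_true] at this
  rw [this] at hi
  exact not_nonempty_empty hi

theorem exc_interior {n d : ℕ} (f : Fin d → Fin n) (hf : Function.Injective f)
    {X : R → R → Set (Fin n → R)} (hX : FamC L X)
    (hd : projDim (fUnion X) = ((d : ℕ∞) : WithBot ℕ∞)) :
    interior (fUnion (excFam f X)) = ∅ := by
  by_contra hne
  obtain ⟨r, s, hr, hs, hi⟩ := BaireC.fin (L := L) (R := R) d _ (famC_exc f hX)
    (nonempty_iff_ne_empty.2 hne)
  have : excFam f X r s = ⋃ j, base (prj f j '' X r s) s := by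
    ext x
    simp [excFam]
  rw [this] at hi
  obtain ⟨j, hj⟩ := exists_interior_of_iUnion
    (fun j => (famC_prj f j hX).base.closed r s hr hs) hi
  obtain ⟨c, e, hb⟩ := (famC_prj f j hX).bdd_snd hr hs
  obtain ⟨⟨x, t⟩, hxt⟩ := interior_of_base L ((famC_prj f j hX).ds1 r s)
    ((famC_prj f j hX).closed r s hr hs) hb hs hj
  by_cases hjf : ∃ i, f i = j
  · obtain ⟨i, rfl⟩ := hjf
    obtain ⟨U, V, hU, hV, hxU, htV, hUV⟩ := isOpen_prod_iff.1 isOpen_interior x t hxt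
    have hVs : V ⊆ {x i} := by
      intro v hv
      obtain ⟨y, hy, hyx⟩ := interior_subset (hUV (show (x, v) ∈ U ×ˢ V from ⟨hxU, hv⟩))
      have h1 : (fun i => y (f i)) = x := congrArg Prod.fst hyx
      have h2 : y (f i) = v := congrArg Prod.snd hyx
      rw [← h1]
      exact h2.symm
    refine not_locFin_of_interior (S := {x i}) ⟨t, interior_maximal hVs hV htV⟩ ?_
    exact fun z => ⟨univ, isOpen_univ, mem_univ z, (finite_singleton _).subset inter_subset_left⟩
  · push Not at hjf
    have hinj : Function.Injective (Fin.snoc f j : Fin (d + 1) → Fin n) := by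
      rw [Fin.snoc_injective_iff]
      exact ⟨hf, by rintro ⟨i, hi⟩; exact hjf i hi⟩
    have hle : (((d + 1 : ℕ) : ℕ∞) : WithBot ℕ∞) ≤ projDim (fUnion X) := by
      refine le_sSup ⟨d + 1, rfl, Fin.snoc f j, hinj, Fin.snoc x t, ?_⟩
      set ψ : (Fin (d + 1) → R) → (Fin d → R) × R :=
        fun v => (fun i => v i.castSucc, v (Fin.last d)) with hψ
      have hψc : Continuous ψ := by fun_prop
      refine interior_maximal (t := ψ ⁻¹' interior (prj f j '' X r s)) ?_
        (isOpen_interior.preimage hψc) ?_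
      · intro v hv
        obtain ⟨y, hy, hyv⟩ := interior_subset hv
        refine ⟨y, ⟨r, s, hr, hs, hy⟩, ?_⟩
        have h1 : (fun i => y (f i)) = fun i => v (Fin.castSucc i) := congrArg Prod.fst hyv
        have h2 : y j = v (Fin.last d) := congrArg Prod.snd hyv
        funext i
        refine Fin.lastCases ?_ (fun i => ?_) i
        · simpa using h2
        · simpa using congrFun h1 i
      · simpa [hψ] using hxt
    rw [hd] at hle
    have : d + 1 ≤ d := by exact_mod_cast hle
    omega

theorem exc_fiber {n d : ℕ} (f : Fin d → Fin n)
    {X : R → R → Set (Fin n → R)} (hX : FamC L X) {x : Fin d → R}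
    (hx : x ∉ fUnion (excFam f X)) : LocFin (fUnion X ∩ {y | y ∘ f = x}) := by
  intro y0
  have key : ∀ j : Fin n, LocFin {t | (x, t) ∈ fUnion fun r s => prj f j '' X r s} := by
    intro j
    refine (famC_prj f j hX).fiber_locFin ?_
    rintro ⟨r, s, hr, hs, h⟩
    exact hx ⟨r, s, hr, hs, j, h⟩
  choose U hU hyU hfin using fun j => key j (y0 j)
  refine ⟨Set.pi univ U, isOpen_set_pi finite_univ fun j _ => hU j, fun j _ => hyU j, ?_⟩
  refine (Set.Finite.pi hfin).subset ?_
  rintro y ⟨⟨⟨r, s, hr, hs, hy⟩, hyx⟩, hyU'⟩ j _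
  exact ⟨⟨r, s, hr, hs, y, hy, Prod.ext hyx rfl⟩, hyU' j (mem_univ j)⟩

end Main

/-- Let `𝓡` be a definably complete expansion of a densely linearly
ordered abelian group satisfying `LUF₂`. Let `X ⊆ R^n` be a `D_Σ`-set with
`proj.dim X = d` and let `π : R^n → R^d` be a coordinate projection (given by an
injection `f` of coordinates) such that `π(X)` has nonempty interior. Then there is a
`D_Σ`-set `Z ⊆ R^d` with empty interior such that `X ∩ π⁻¹(x)` is locally finite for
every `x ∈ R^d \ Z`. -/
theorem dSigma_generic_fibers_locally_finite
    {R : Type*} (L : FirstOrder.Language) [L.Structure R]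
    [LinearOrder R] [DenselyOrdered R] [AddCommGroup R]
    [CovariantClass R R (· + ·) (· < ·)] [TopologicalSpace R] [OrderTopology R]
    (hlt : IsDefinable L {v : Fin 2 → R | v 0 < v 1})
    (hadd : IsDefinable L {v : Fin 3 → R | v 0 + v 1 = v 2})
    (hDC : DCProp L R) (hLUF2 : LUF2 L R)
    {n d : ℕ} (X : Set (Fin n → R)) (hX : IsDSigma L X)
    (hd : projDim X = ((d : ℕ∞) : WithBot ℕ∞))
    (f : Fin d → Fin n) (hf : Function.Injective f)
    (hπ : (interior ((fun y => y ∘ f) '' X)).Nonempty) :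
    ∃ Z : Set (Fin d → R), IsDSigma L Z ∧ interior Z = ∅ ∧
      ∀ x : Fin d → R, x ∉ Z → LocFin (X ∩ {y : Fin n → R | y ∘ f = x}) := by
  haveI hmono : IsOrderedAddMonoid R :=
    { add_le_add_left := fun a b hab c => by
        rcases hab.eq_or_lt with rfl | h
        · exact le_rfl
        · have := (CovariantClass.elim c h : c + a < c + b)
          rw [add_comm a c, add_comm b c]
          exact this.le }
  haveI hnt : Nontrivial R := by
    obtain ⟨N, -, p, q, -, U, ⟨c, e, rfl⟩, hb, -⟩ :=
      hLUF2 1 Set.univ Set.definable_univ 0 (fun _ => 0)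
    exact ⟨c 0, 0, (hb 0).1.ne⟩
  haveI hstd : StdC L R := { lt := hlt, add := hadd, dc := hDC, luf := hLUF2 }
  obtain ⟨F, hF, hXF⟩ := hX
  have hfam := famC_of_dSigma hF
  have hXU : X = fUnion (fun r s => famFiber F r s) := by
    rw [hXF]
    ext x
    simp only [fUnion, mem_iUnion, mem_ofPred_eq]
    constructor
    · rintro ⟨r, hr, s, hs, hx⟩
      exact ⟨r, s, hr, hs, hx⟩
    · rintro ⟨r, s, hr, hs, hx⟩
      exact ⟨r, hr, s, hs, hx⟩
  subst hXU
  exact ⟨_, dSigma_of_famC (famC_exc f hfam), exc_interior f hf hfam hd,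
    fun x hx => exc_fiber f hfam hx⟩
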